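/- Let Φ(y) = (1+y)log(1+y) − y for y ≥ 0 (the conjugate of exp₂) and let κ > 0 be the positive root of √(π/2) κ + (π²/4) κ² = 1. Then ∫ max((π/2)κ|z|, ((π/2)κ|z|)²) dγ₁(z) ≤ 1, and for every f ∈ C¹_poly(ℝⁿ) the Poincaré-type inequality ‖f − f̄‖_{L_Φ(γ)} ≤ κ^{-1} ‖|∇f|‖_{L_Φ(γ)} holds. -/

import Mathlib

open MeasureTheory Real
open scoped RealInnerProductSpace BigOperators

noncomputable section

/-- The standard Gaussian measure on `ℝⁿ`, with density
`(2π)^(-n/2) exp(-|x|²/2)` with respect to Lebesgue measure. -/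
def gaussianMeasure (n : ℕ) : Measure (EuclideanSpace ℝ (Fin n)) :=
  volume.withDensity fun x => ENNReal.ofReal ((2 * π) ^ (-(n : ℝ) / 2) * Real.exp (-‖x‖ ^ 2 / 2))

/-- `C^k_poly(ℝⁿ)`: `C^k` functions which, together with all derivatives up to
order `k`, are bounded by a polynomial. -/
def CPoly (k n : ℕ) (f : EuclideanSpace ℝ (Fin n) → ℝ) : Prop :=
  ContDiff ℝ k f ∧
    ∀ i, i ≤ k → ∃ (C : ℝ) (m : ℕ), ∀ x, ‖iteratedFDeriv ℝ i f x‖ ≤ C * (1 + ‖x‖) ^ m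

/-- The `i`-th partial derivative. -/
def partialDeriv {n : ℕ} (i : Fin n) (f : EuclideanSpace ℝ (Fin n) → ℝ)
    (x : EuclideanSpace ℝ (Fin n)) : ℝ :=
  fderiv ℝ f x (EuclideanSpace.single i 1)

/-- The Laplacian. -/
def laplacian {n : ℕ} (f : EuclideanSpace ℝ (Fin n) → ℝ) (x : EuclideanSpace ℝ (Fin n)) : ℝ :=
  ∑ i : Fin n, partialDeriv i (partialDeriv i f) x

/-- The Ornstein–Uhlenbeck operator `δ·∇ f (x) = x·∇f(x) − Δf(x)`. -/
def ouOperator {n : ℕ} (f : EuclideanSpace ℝ (Fin n) → ℝ) (x : EuclideanSpace ℝ (Fin n)) : ℝ :=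
  ⟪x, gradient f x⟫ - laplacian f x

/-- The Ornstein–Uhlenbeck semigroup given by the Mehler formula. -/
def ouSemigroup (n : ℕ) (t : ℝ) (f : EuclideanSpace ℝ (Fin n) → ℝ)
    (x : EuclideanSpace ℝ (Fin n)) : ℝ :=
  ∫ y, f (Real.exp (-t) • x + Real.sqrt (1 - Real.exp (-2 * t)) • y) ∂gaussianMeasure n

/-- A Young function: the primitive of a continuous, strictly increasing function
`φ` with `φ(0) = 0` and `φ(u) → ∞`. -/
def IsYoung (Φ : ℝ → ℝ) : Prop :=
  ∃ φ : ℝ → ℝ, ContinuousOn φ (Set.Ici 0) ∧ StrictMonoOn φ (Set.Ici 0) ∧ φ 0 = 0 ∧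
    Filter.Tendsto φ Filter.atTop Filter.atTop ∧
    ∀ x, 0 ≤ x → Φ x = ∫ u in (0:ℝ)..x, φ u

/-- The Luxemburg norm of `f` in the Orlicz space `L_Φ(γ)` over the Gaussian space. -/
def luxNorm (n : ℕ) (Φ : ℝ → ℝ) (f : EuclideanSpace ℝ (Fin n) → ℝ) : ℝ :=
  sInf {α : ℝ | 0 < α ∧ ∫ x, Φ (|f x| / α) ∂gaussianMeasure n ≤ 1}

end

/-- The Young function conjugate to `exp₂`, extended by the same formula to all reals. -/
noncomputable def expTwoConj (y : ℝ) : ℝ := (1 + y) * Real.log (1 + y) - y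

theorem expTwoConj_zero : expTwoConj 0 = 0 := by simp [expTwoConj]

theorem hasDerivAt_expTwoConj {y : ℝ} (hy : 0 ≤ y) :
    HasDerivAt expTwoConj (Real.log (1 + y)) y := by
  have h1 : HasDerivAt (fun y : ℝ => 1 + y) 1 y := (hasDerivAt_id y).const_add 1
  have hne : 1 + y ≠ 0 := by positivity
  refine ((h1.mul (h1.log hne)).sub (hasDerivAt_id y)).congr_deriv ?_
  field_simp
  ring

theorem continuousOn_expTwoConj : ContinuousOn expTwoConj (Set.Ici 0) := fun _ hy =>
  (hasDerivAt_expTwoConj hy).continuousAt.continuousWithinAt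

theorem monotoneOn_expTwoConj : MonotoneOn expTwoConj (Set.Ici 0) := by
  refine monotoneOn_of_deriv_nonneg (convex_Ici 0) continuousOn_expTwoConj ?_ ?_
  all_goals
    intro y hy
    have hy0 : 0 ≤ y := interior_subset (s := Set.Ici (0 : ℝ)) hy
  · exact (hasDerivAt_expTwoConj hy0).differentiableAt.differentiableWithinAt
  · rw [(hasDerivAt_expTwoConj hy0).deriv]
    exact Real.log_nonneg (by linarith)

theorem convexOn_expTwoConj : ConvexOn ℝ (Set.Ici 0) expTwoConj := by
  refine MonotoneOn.convexOn_of_deriv (convex_Ici 0) continuousOn_expTwoConj ?_ ?_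
  · intro y hy
    have hy0 : 0 ≤ y := interior_subset (s := Set.Ici (0 : ℝ)) hy
    exact (hasDerivAt_expTwoConj hy0).differentiableAt.differentiableWithinAt
  · intro a ha b hb hab
    have ha0 : 0 ≤ a := interior_subset (s := Set.Ici (0 : ℝ)) ha
    have hb0 : 0 ≤ b := interior_subset (s := Set.Ici (0 : ℝ)) hb
    rw [(hasDerivAt_expTwoConj ha0).deriv, (hasDerivAt_expTwoConj hb0).deriv]
    exact Real.log_le_log (by linarith) (by linarith)

theorem expTwoConj_nonneg {y : ℝ} (hy : 0 ≤ y) : 0 ≤ expTwoConj y := by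
  rw [← expTwoConj_zero]
  exact monotoneOn_expTwoConj Set.self_mem_Ici hy hy

theorem expTwoConj_le_sq {y : ℝ} (hy : 0 ≤ y) : expTwoConj y ≤ y ^ 2 := by
  have h : Real.log (1 + y) ≤ y := by
    linarith [Real.log_le_sub_one_of_pos (show 0 < 1 + y by linarith)]
  unfold expTwoConj
  nlinarith

theorem antitoneOn_expTwoConj_div_sq :
    AntitoneOn (fun y => expTwoConj y / y ^ 2) (Set.Ioi 0) := by
  have hd : ∀ y : ℝ, 0 < y → HasDerivAt (fun y => expTwoConj y / y ^ 2)
      ((Real.log (1 + y) * y ^ 2 - expTwoConj y * (2 * y)) / (y ^ 2) ^ 2) y := by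
    intro y hy
    refine ((hasDerivAt_expTwoConj hy.le).div (hasDerivAt_pow 2 y) (by positivity)).congr_deriv ?_
    simp
  refine antitoneOn_of_deriv_nonpos (convex_Ioi 0)
    (fun y hy => (hd y hy).continuousAt.continuousWithinAt) ?_ ?_
  all_goals
    rw [interior_Ioi]
    intro y hy
  · exact (hd y hy).differentiableAt.differentiableWithinAt
  · have hy0 : 0 < y := hy
    rw [(hd y hy).deriv]
    refine div_nonpos_of_nonpos_of_nonneg ?_ (by positivity)
    have h := Real.le_log_one_add_of_nonneg hy0.le
    rw [div_le_iff₀ (by positivity)] at h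
    unfold expTwoConj
    nlinarith

theorem expTwoConj_mul_le {t y : ℝ} (ht : 0 ≤ t) (hy : 0 ≤ y) :
    expTwoConj (t * y) ≤ max t (t ^ 2) * expTwoConj y := by
  have hΦ := expTwoConj_nonneg hy
  rcases le_total t 1 with h1 | h1
  · have h := convexOn_expTwoConj.2 (Set.mem_Ici.2 hy) (Set.self_mem_Ici (a := (0 : ℝ))) ht
      (sub_nonneg.2 h1) (by ring)
    simp only [smul_eq_mul, mul_zero, add_zero, expTwoConj_zero] at h
    exact h.trans (mul_le_mul_of_nonneg_right (le_max_left _ _) hΦ)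
  · refine le_trans ?_ (mul_le_mul_of_nonneg_right (le_max_right _ _) hΦ)
    rcases hy.eq_or_lt with rfl | hy0
    · simp [expTwoConj_zero]
    have ht0 : 0 < t := by linarith
    have h := antitoneOn_expTwoConj_div_sq (Set.mem_Ioi.2 hy0)
      (Set.mem_Ioi.2 (mul_pos ht0 hy0)) (le_mul_of_one_le_left hy h1)
    simp only at h
    rw [div_le_div_iff₀ (by positivity) (by positivity)] at h
    have hy2 : 0 < y ^ 2 := by positivity
    nlinarith

theorem convexOn_expTwoConj_abs : ConvexOn ℝ Set.univ fun y : ℝ => expTwoConj |y| := by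
  have himg : (fun y : ℝ => |y|) '' Set.univ ⊆ Set.Ici 0 := by
    rintro _ ⟨y, -, rfl⟩
    exact abs_nonneg y
  have habs : ConvexOn ℝ Set.univ fun y : ℝ => |y| := convexOn_univ_norm (E := ℝ)
  have hconv : Convex ℝ ((fun y : ℝ => |y|) '' Set.univ) := by
    have : (fun y : ℝ => |y|) '' Set.univ = Set.Ici 0 :=
      himg.antisymm fun y hy => ⟨y, trivial, abs_of_nonneg hy⟩
    rw [this]
    exact convex_Ici 0
  exact (convexOn_expTwoConj.subset himg hconv).comp habs (monotoneOn_expTwoConj.mono himg)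

theorem continuous_expTwoConj_abs : Continuous fun y : ℝ => expTwoConj |y| :=
  continuousOn_expTwoConj.comp_continuous continuous_abs abs_nonneg

theorem expTwoConj_abs_le_sq (y : ℝ) : expTwoConj |y| ≤ y ^ 2 := by
  simpa using expTwoConj_le_sq (abs_nonneg y)

theorem integral_abs_gaussianReal :
    ∫ z, |z| ∂ProbabilityTheory.gaussianReal 0 1 = Real.sqrt (2 / π) := by
  rw [ProbabilityTheory.integral_gaussianReal_eq_integral_smul (by norm_num)]
  have h := integral_rpow_mul_exp_neg_mul_rpow (p := 2) (q := 1) (b := 1 / 2)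
    (by norm_num) (by norm_num) (by norm_num)
  have hI : ∫ x in Set.Ioi (0 : ℝ), x * Real.exp (-(1 / 2) * x ^ 2) = 1 := by
    norm_num at h
    simpa using h
  have hpt : ∀ x : ℝ, ProbabilityTheory.gaussianPDFReal 0 1 x • |x| =
      (Real.sqrt (2 * π))⁻¹ * (fun x => x * Real.exp (-(1 / 2) * x ^ 2)) |x| := by
    intro x
    simp only [ProbabilityTheory.gaussianPDFReal, NNReal.coe_one, smul_eq_mul, sq_abs, sub_zero,
      mul_one]
    rw [show -(1 / 2) * x ^ 2 = -x ^ 2 / 2 by ring]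
    ring
  simp_rw [hpt]
  rw [integral_const_mul,
    integral_comp_abs (f := fun x => x * Real.exp (-(1 / 2) * x ^ 2)), hI, Real.sqrt_div (by norm_num),
    Real.sqrt_mul (by norm_num)]
  have h2 := Real.mul_self_sqrt (show (0 : ℝ) ≤ 2 by norm_num)
  have : 0 < Real.sqrt π := Real.sqrt_pos.2 Real.pi_pos
  field_simp
  linarith

theorem integrable_abs_gaussianReal :
    Integrable (fun z : ℝ => |z|) (ProbabilityTheory.gaussianReal 0 1) :=
  (ProbabilityTheory.IsGaussian.integrable_id (μ := ProbabilityTheory.gaussianReal 0 1)).abs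

theorem integrable_sq_gaussianReal :
    Integrable (fun z : ℝ => z ^ 2) (ProbabilityTheory.gaussianReal 0 1) :=
  (ProbabilityTheory.IsGaussian.memLp_two_id
    (μ := ProbabilityTheory.gaussianReal 0 1)).integrable_sq

theorem integral_sq_gaussianReal :
    ∫ z, z ^ 2 ∂ProbabilityTheory.gaussianReal 0 1 = 1 := by
  have h := ProbabilityTheory.variance_of_integral_eq_zero (X := id)
    (μ := ProbabilityTheory.gaussianReal 0 1) aemeasurable_id
    (by simp)
  simpa using h.symm

theorem integrable_max_abs_sq_gaussianReal (a : ℝ) :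
    Integrable (fun z : ℝ => max (a * |z|) ((a * |z|) ^ 2))
      (ProbabilityTheory.gaussianReal 0 1) :=
  (integrable_abs_gaussianReal.const_mul a).sup
    ((integrable_sq_gaussianReal.const_mul (a ^ 2)).congr
      (Filter.Eventually.of_forall fun z => by simp [mul_pow]))

theorem integral_max_abs_sq_gaussianReal_le {a : ℝ} (ha : 0 ≤ a) :
    ∫ z, max (a * |z|) ((a * |z|) ^ 2) ∂ProbabilityTheory.gaussianReal 0 1 ≤
      a * Real.sqrt (2 / π) + a ^ 2 := by
  have hi := (integrable_abs_gaussianReal.const_mul a).add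
    (integrable_sq_gaussianReal.const_mul (a ^ 2))
  refine (integral_mono (integrable_max_abs_sq_gaussianReal a) hi fun z => ?_).trans_eq ?_
  · have h1 : 0 ≤ a * |z| := by positivity
    have h2 : 0 ≤ a ^ 2 * z ^ 2 := by positivity
    have h3 : (a * |z|) ^ 2 = a ^ 2 * z ^ 2 := by rw [mul_pow, sq_abs]
    simp only [Pi.add_apply]
    rw [h3]
    exact max_le (by linarith) (by linarith)
  · simp only [Pi.add_apply]
    rw [integral_add (integrable_abs_gaussianReal.const_mul a)
      (integrable_sq_gaussianReal.const_mul (a ^ 2)), integral_const_mul, integral_const_mul,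
      integral_abs_gaussianReal, integral_sq_gaussianReal, mul_one]

open ProbabilityTheory in
theorem gaussianMeasure_eq_stdGaussian (n : ℕ) :
    gaussianMeasure n = stdGaussian (EuclideanSpace ℝ (Fin n)) := by
  have hpos : ∀ x : EuclideanSpace ℝ (Fin n),
      0 ≤ (2 * π) ^ (-(n : ℝ) / 2) * Real.exp (-‖x‖ ^ 2 / 2) := fun x => by positivity
  have hmeas : Measurable fun x : EuclideanSpace ℝ (Fin n) =>
      (2 * π) ^ (-(n : ℝ) / 2) * Real.exp (-‖x‖ ^ 2 / 2) := by fun_prop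
  have hint : Integrable fun x : EuclideanSpace ℝ (Fin n) =>
      (2 * π) ^ (-(n : ℝ) / 2) * Real.exp (-‖x‖ ^ 2 / 2) := by
    have h := GaussianFourier.integrable_cexp_neg_mul_sq_norm_add (V := EuclideanSpace ℝ (Fin n))
      (b := 1 / 2) (by norm_num) 0 0
    refine Integrable.const_mul (h.norm.congr (Filter.Eventually.of_forall fun x => ?_)) _
    simp only [Complex.norm_exp]
    congr 1
    norm_num [← Complex.ofReal_pow]
    ring
  have hfin : IsFiniteMeasure (gaussianMeasure n) :=
    isFiniteMeasure_withDensity_ofReal hint.2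
  refine Measure.ext_of_charFun ?_
  ext t
  rw [charFun_stdGaussian, charFun_apply, gaussianMeasure,
    integral_withDensity_eq_integral_toReal_smul hmeas.ennreal_ofReal
      (Filter.Eventually.of_forall fun _ => ENNReal.ofReal_lt_top)]
  have h := GaussianFourier.integral_cexp_neg_mul_sq_norm_add (V := EuclideanSpace ℝ (Fin n))
    (b := 1 / 2) (by norm_num) Complex.I t
  have hpt : ∀ x : EuclideanSpace ℝ (Fin n),
      (ENNReal.ofReal ((2 * π) ^ (-(n : ℝ) / 2) * Real.exp (-‖x‖ ^ 2 / 2))).toReal •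
        Complex.exp (⟪x, t⟫ * Complex.I) =
      (((2 * π) ^ (-(n : ℝ) / 2) : ℝ) : ℂ) *
        Complex.exp (-(1 / 2) * ‖x‖ ^ 2 + Complex.I * ⟪t, x⟫) := by
    intro x
    rw [ENNReal.toReal_ofReal (hpos x), Complex.real_smul, Complex.ofReal_mul, mul_assoc,
      Complex.ofReal_exp, ← Complex.exp_add, real_inner_comm]
    congr 2
    push_cast
    ring
  simp_rw [hpt]
  rw [integral_const_mul, h, ← mul_assoc]
  have hc : (((2 * π) ^ (-(n : ℝ) / 2) : ℝ) : ℂ) *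
      ((π : ℂ) / (1 / 2)) ^ (Module.finrank ℝ (EuclideanSpace ℝ (Fin n)) / 2 : ℂ) = 1 := by
    have h2 : ((π : ℂ) / (1 / 2)) ^ (Module.finrank ℝ (EuclideanSpace ℝ (Fin n)) / 2 : ℂ) =
        (((2 * π) ^ ((n : ℝ) / 2) : ℝ) : ℂ) := by
      rw [Complex.ofReal_cpow (by positivity)]
      simp only [finrank_euclideanSpace, Fintype.card_fin]
      push_cast
      congr 1
      ring
    rw [h2, ← Complex.ofReal_mul, ← Real.rpow_add (by positivity)]
    norm_num [neg_div]
  rw [hc, one_mul, Complex.I_sq]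
  congr 1
  ring

theorem integrable_of_polynomial_growth {F : Type*} [NormedAddCommGroup F] [NormedSpace ℝ F]
    [CompleteSpace F] [SecondCountableTopology F] [MeasurableSpace F] [BorelSpace F]
    {μ : Measure F} [ProbabilityTheory.IsGaussian μ] {g : F → ℝ} (hg : Continuous g) {C : ℝ}
    {m : ℕ} (hb : ∀ x, |g x| ≤ C * (1 + ‖x‖) ^ m) : Integrable g μ := by
  have h1 : MemLp (fun x : F => 1 + ‖x‖) m μ :=
    MemLp.add (f := fun _ => (1 : ℝ)) (g := fun x : F => ‖x‖) (memLp_const 1)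
      (ProbabilityTheory.IsGaussian.memLp_id μ m (ENNReal.natCast_ne_top m)).norm
  have h2 : Integrable (fun x : F => C * (1 + ‖x‖) ^ m) μ := by
    refine (h1.integrable_norm_pow'.congr (Filter.Eventually.of_forall fun x => ?_)).const_mul C
    simp only [Real.norm_eq_abs]
    rw [abs_of_nonneg (by positivity)]
  exact h2.mono' hg.aestronglyMeasurable (Filter.Eventually.of_forall hb)

section MaureyPisier

variable {E : Type*} [NormedAddCommGroup E] [NormedSpace ℝ E]

theorem norm_rotation_le (θ : ℝ) (p : E × E) :
    ‖ContinuousLinearMap.rotation θ p‖ ≤ 2 * ‖p‖ := by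
  have hs := Real.abs_sin_le_one θ
  have hc := Real.abs_cos_le_one θ
  have h1 := norm_fst_le p
  have h2 := norm_snd_le p
  have hcomb : ∀ a b : ℝ, |a| ≤ 1 → |b| ≤ 1 → ‖a • p.1 + b • p.2‖ ≤ 2 * ‖p‖ := by
    intro a b ha hb
    refine (norm_add_le _ _).trans ?_
    rw [norm_smul, norm_smul, Real.norm_eq_abs, Real.norm_eq_abs]
    linarith [mul_le_of_le_one_left (norm_nonneg p.1) ha,
      mul_le_of_le_one_left (norm_nonneg p.2) hb]
  rw [ContinuousLinearMap.rotation_apply, norm_prod_le_iff]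
  exact ⟨hcomb _ _ hc hs, hcomb _ _ (by rwa [abs_neg]) hc⟩

theorem hasDerivAt_rotation_fst (p : E × E) (θ : ℝ) :
    HasDerivAt (fun θ => (ContinuousLinearMap.rotation θ p).1)
      (ContinuousLinearMap.rotation θ p).2 θ := by
  simp only [ContinuousLinearMap.rotation_apply]
  exact ((Real.hasDerivAt_cos θ).smul_const p.1).add ((Real.hasDerivAt_sin θ).smul_const p.2)

theorem continuous_rotation :
    Continuous fun q : ℝ × (E × E) => ContinuousLinearMap.rotation q.1 q.2 := by
  simp only [ContinuousLinearMap.rotation_apply]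
  fun_prop

theorem continuous_rotation_left (p : E × E) :
    Continuous fun θ : ℝ => ContinuousLinearMap.rotation θ p := by
  simp only [ContinuousLinearMap.rotation_apply]
  fun_prop

theorem continuous_fderiv_apply {f : E → ℝ} (hf : ContDiff ℝ 1 f) :
    Continuous fun p : E × E => fderiv ℝ f p.1 p.2 :=
  hf.continuous_fderiv_apply one_ne_zero

theorem integral_fderiv_rotation {f : E → ℝ} (hf : ContDiff ℝ 1 f) (p : E × E) :
    ∫ θ in (0 : ℝ)..(π / 2), fderiv ℝ f (ContinuousLinearMap.rotation θ p).1
      (ContinuousLinearMap.rotation θ p).2 = f p.2 - f p.1 := by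
  have hcont : Continuous fun θ : ℝ => fderiv ℝ f (ContinuousLinearMap.rotation θ p).1
      (ContinuousLinearMap.rotation θ p).2 :=
    (continuous_fderiv_apply hf).comp (continuous_rotation_left p)
  rw [intervalIntegral.integral_eq_sub_of_hasDerivAt
    (f := fun θ => f (ContinuousLinearMap.rotation θ p).1)
    (fun θ _ => ((hf.differentiable one_ne_zero _).hasFDerivAt.comp_hasDerivAt θ
      (hasDerivAt_rotation_fst p θ))) (hcont.intervalIntegrable _ _)]
  simp [ContinuousLinearMap.rotation_apply]

theorem abs_fderiv_apply_le {f : E → ℝ} {C : ℝ} {m : ℕ}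
    (hb : ∀ x, ‖fderiv ℝ f x‖ ≤ C * (1 + ‖x‖) ^ m) (p : E × E) :
    |fderiv ℝ f p.1 p.2| ≤ C * (1 + ‖p‖) ^ (m + 1) := by
  have hC : 0 ≤ C := by simpa using (norm_nonneg _).trans (hb 0)
  calc |fderiv ℝ f p.1 p.2| ≤ ‖fderiv ℝ f p.1‖ * ‖p.2‖ := (fderiv ℝ f p.1).le_opNorm p.2
    _ ≤ (C * (1 + ‖p‖) ^ m) * (1 + ‖p‖) := by
      gcongr
      · refine (hb p.1).trans ?_
        gcongr
        exact norm_fst_le p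
      · linarith [norm_snd_le p]
    _ = C * (1 + ‖p‖) ^ (m + 1) := by ring

theorem abs_convex_fderiv_le {Ψ : ℝ → ℝ} (h0 : ∀ y, 0 ≤ Ψ y) {K : ℝ} (hK : 0 ≤ K)
    (h2 : ∀ y, Ψ y ≤ K * y ^ 2) (a : ℝ) {f : E → ℝ} {C : ℝ} {m : ℕ}
    (hb : ∀ x, ‖fderiv ℝ f x‖ ≤ C * (1 + ‖x‖) ^ m) (p : E × E) :
    |Ψ (a * fderiv ℝ f p.1 p.2)| ≤ K * a ^ 2 * C ^ 2 * (1 + ‖p‖) ^ (2 * (m + 1)) := by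
  rw [abs_of_nonneg (h0 _)]
  have h := pow_le_pow_left₀ (abs_nonneg _) (abs_fderiv_apply_le hb p) 2
  rw [sq_abs] at h
  calc Ψ (a * fderiv ℝ f p.1 p.2) ≤ K * (a * fderiv ℝ f p.1 p.2) ^ 2 := h2 _
    _ = K * a ^ 2 * fderiv ℝ f p.1 p.2 ^ 2 := by ring
    _ ≤ K * a ^ 2 * (C * (1 + ‖p‖) ^ (m + 1)) ^ 2 := by gcongr
    _ = _ := by ring

variable [CompleteSpace E] [SecondCountableTopology E] [MeasurableSpace E] [BorelSpace E]
  {μ : Measure E} [ProbabilityTheory.IsGaussian μ]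

/-- Maurey–Pisier comparison: for a centered Gaussian measure, the fluctuation of `f` around its
mean is dominated, in the sense of convex functions, by `π / 2` times the derivative of `f` in an
independent Gaussian direction. -/
theorem integral_convex_sub_le_integral_fderiv (hμ : ∫ x, id x ∂μ = 0) {Ψ : ℝ → ℝ}
    (hΨ : ConvexOn ℝ Set.univ Ψ) (hΨc : Continuous Ψ) (h0 : ∀ y, 0 ≤ Ψ y) {K : ℝ} (hK : 0 ≤ K)
    (h2 : ∀ y, Ψ y ≤ K * y ^ 2) {f : E → ℝ} (hf : ContDiff ℝ 1 f) {C C' : ℝ} {m m' : ℕ}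
    (hfb : ∀ x, |f x| ≤ C' * (1 + ‖x‖) ^ m')
    (hb : ∀ x, ‖fderiv ℝ f x‖ ≤ C * (1 + ‖x‖) ^ m) :
    ∫ x, Ψ ((∫ y, f y ∂μ) - f x) ∂μ ≤
      ∫ p, Ψ (π / 2 * fderiv ℝ f p.1 p.2) ∂(μ.prod μ) := by
  have hpi := Real.pi_pos
  have hfi : Integrable f μ := integrable_of_polynomial_growth hf.continuous hfb
  have hC' : 0 ≤ C' := by simpa using (abs_nonneg _).trans (hfb 0)
  have hf2 : ∀ p : E × E, |f p.2 - f p.1| ≤ 2 * C' * (1 + ‖p‖) ^ m' := by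
    intro p
    have h1 : |f p.1| ≤ C' * (1 + ‖p‖) ^ m' := (hfb _).trans (by gcongr; exact norm_fst_le p)
    have h2 : |f p.2| ≤ C' * (1 + ‖p‖) ^ m' := (hfb _).trans (by gcongr; exact norm_snd_le p)
    linarith [abs_sub (f p.2) (f p.1)]
  have hdiffi : Integrable (fun p : E × E => Ψ (f p.2 - f p.1)) (μ.prod μ) := by
    have hfc := hf.continuous
    refine integrable_of_polynomial_growth (C := K * (2 * C') ^ 2) (m := m' * 2)
      (by fun_prop) fun p => ?_
    rw [abs_of_nonneg (h0 _)]
    refine (h2 _).trans ?_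
    have h := pow_le_pow_left₀ (abs_nonneg _) (hf2 p) 2
    rw [sq_abs] at h
    calc K * (f p.2 - f p.1) ^ 2 ≤ K * (2 * C' * (1 + ‖p‖) ^ m') ^ 2 := by gcongr
      _ = _ := by ring
  set ν : Measure ℝ := volume.restrict (Set.Ioc 0 (π / 2)) with hν
  set H : ℝ × (E × E) → ℝ := fun q =>
    Ψ (π / 2 * fderiv ℝ f (ContinuousLinearMap.rotation q.1 q.2).1
      (ContinuousLinearMap.rotation q.1 q.2).2)
  have hGc : Continuous fun q : ℝ × (E × E) =>
      fderiv ℝ f (ContinuousLinearMap.rotation q.1 q.2).1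
        (ContinuousLinearMap.rotation q.1 q.2).2 :=
    (continuous_fderiv_apply hf).comp continuous_rotation
  have hHc : Continuous H := hΨc.comp (continuous_const.mul hGc)
  have hHi : Integrable H (ν.prod (μ.prod μ)) := by
    set g : E × E → ℝ := fun p =>
      K * (π / 2) ^ 2 * C ^ 2 * (1 + 2 * ‖p‖) ^ (2 * (m + 1)) with hg
    have hgi : Integrable g (μ.prod μ) := by
      refine integrable_of_polynomial_growth
        (C := K * (π / 2) ^ 2 * C ^ 2 * 2 ^ (2 * (m + 1))) (m := 2 * (m + 1))
        (by fun_prop) fun p => ?_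
      rw [abs_of_nonneg (by positivity), mul_assoc (K * (π / 2) ^ 2 * C ^ 2), ← mul_pow]
      simp only [hg]
      gcongr
      linarith [norm_nonneg p]
    refine (hgi.comp_snd ν).mono' hHc.aestronglyMeasurable
      (Filter.Eventually.of_forall fun q => ?_)
    refine (abs_convex_fderiv_le h0 hK h2 _ hb _).trans ?_
    simp only [hg]
    gcongr
    exact norm_rotation_le _ _
  have hJensenθ : ∀ p : E × E, Ψ (f p.2 - f p.1) ≤ (π / 2)⁻¹ * ∫ θ, H (θ, p) ∂ν := by
    intro p
    have hGp : Continuous fun θ : ℝ => π / 2 * fderiv ℝ f (ContinuousLinearMap.rotation θ p).1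
        (ContinuousLinearMap.rotation θ p).2 :=
      continuous_const.mul ((continuous_fderiv_apply hf).comp (continuous_rotation_left p))
    have hJ := hΨ.map_set_average_le (μ := volume) (t := Set.Ioc 0 (π / 2)) hΨc.continuousOn
      isClosed_univ (by simp [hpi]) (by simp) (by simp)
      (hGp.integrableOn_Ioc) ((hΨc.comp hGp).integrableOn_Ioc)
    have hvol : volume.real (Set.Ioc 0 (π / 2)) = π / 2 := by
      simp [Real.volume_real_Ioc_of_le (show (0 : ℝ) ≤ π / 2 by positivity)]
    rw [setAverage_eq, setAverage_eq, hvol, integral_const_mul,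
      ← intervalIntegral.integral_of_le (by positivity), integral_fderiv_rotation hf,
      smul_eq_mul, smul_eq_mul, inv_mul_cancel_left₀ (by positivity)] at hJ
    exact hJ
  have hrot : ∀ θ : ℝ, ∫ p, H (θ, p) ∂(μ.prod μ) =
      ∫ p, Ψ (π / 2 * fderiv ℝ f p.1 p.2) ∂(μ.prod μ) := by
    intro θ
    have hc : Continuous fun p : E × E => Ψ (π / 2 * fderiv ℝ f p.1 p.2) :=
      hΨc.comp (continuous_const.mul (continuous_fderiv_apply hf))
    conv_rhs => rw [← ProbabilityTheory.IsGaussian.map_rotation_eq_self hμ θ]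
    rw [integral_map (ContinuousLinearMap.continuous _).aemeasurable hc.aestronglyMeasurable]
  calc ∫ x, Ψ ((∫ y, f y ∂μ) - f x) ∂μ ≤ ∫ x, ∫ y, Ψ (f y - f x) ∂μ ∂μ := by
        have hle : ∀ᵐ x ∂μ, Ψ ((∫ y, f y ∂μ) - f x) ≤ ∫ y, Ψ (f y - f x) ∂μ := by
          filter_upwards [hdiffi.prod_right_ae] with x hx
          have hJ := hΨ.map_integral_le (μ := μ) (f := fun y => f y - f x) hΨc.continuousOn
            isClosed_univ (by simp) (hfi.sub (integrable_const _)) hx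
          rwa [integral_sub hfi (integrable_const _), integral_const, probReal_univ,
            one_smul] at hJ
        exact integral_mono_of_nonneg (Filter.Eventually.of_forall fun x => h0 _)
          hdiffi.integral_prod_left hle
    _ = ∫ p, Ψ (f p.2 - f p.1) ∂(μ.prod μ) := (integral_prod _ hdiffi).symm
    _ ≤ ∫ p, (π / 2)⁻¹ * ∫ θ, H (θ, p) ∂ν ∂(μ.prod μ) :=
        integral_mono hdiffi (hHi.integral_prod_right.const_mul _) hJensenθ
    _ = (π / 2)⁻¹ * ∫ θ, ∫ p, H (θ, p) ∂(μ.prod μ) ∂ν := by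
        rw [integral_const_mul, integral_integral_swap (f := fun p θ => H (θ, p)) hHi.swap]
    _ = ∫ p, Ψ (π / 2 * fderiv ℝ f p.1 p.2) ∂(μ.prod μ) := by
        simp_rw [hrot]
        rw [integral_const, hν, measureReal_restrict_apply_univ, smul_eq_mul, ← mul_assoc]
        simp only [Real.volume_real_Ioc_of_le (show (0 : ℝ) ≤ π / 2 by positivity), sub_zero]
        rw [inv_mul_cancel₀ (by positivity), one_mul]

end MaureyPisier

open ProbabilityTheory in
theorem map_stdGaussian_strongDual {E : Type*} [NormedAddCommGroup E] [InnerProductSpace ℝ E]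
    [FiniteDimensional ℝ E] [MeasurableSpace E] [BorelSpace E] (L : StrongDual ℝ E) :
    (stdGaussian E).map L = (gaussianReal 0 1).map (‖L‖ * ·) := by
  rw [IsGaussian.map_eq_gaussianReal, integral_strongDual_stdGaussian, variance_dual_stdGaussian,
    gaussianReal_map_const_mul]
  congr 1
  · simp
  · ext
    simp

open ProbabilityTheory in
/-- Modular form of the Poincaré inequality for `expTwoConj`. -/
theorem integral_expTwoConj_sub_le {E : Type*} [NormedAddCommGroup E] [InnerProductSpace ℝ E]
    [FiniteDimensional ℝ E] [MeasurableSpace E] [BorelSpace E] {κ α : ℝ} (hκ : 0 < κ) (hα : 0 < α)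
    {f : E → ℝ} (hf : ContDiff ℝ 1 f) {C C' : ℝ} {m m' : ℕ}
    (hfb : ∀ x, |f x| ≤ C' * (1 + ‖x‖) ^ m')
    (hb : ∀ x, ‖fderiv ℝ f x‖ ≤ C * (1 + ‖x‖) ^ m) :
    ∫ x, expTwoConj (|f x - ∫ y, f y ∂stdGaussian E| / (κ⁻¹ * α)) ∂stdGaussian E ≤
      (∫ z, max (π / 2 * κ * |z|) ((π / 2 * κ * |z|) ^ 2) ∂gaussianReal 0 1) *
        ∫ x, expTwoConj (‖fderiv ℝ f x‖ / α) ∂stdGaussian E := by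
  have hpi := Real.pi_pos
  set μ := stdGaussian E
  set c : ℝ := κ / α with hc
  have hc0 : 0 < c := by positivity
  set Ψ : ℝ → ℝ := fun y => expTwoConj |c * y| with hΨ
  have hΨconv : ConvexOn ℝ Set.univ Ψ := by
    exact convexOn_expTwoConj_abs.comp_linearMap (c • LinearMap.id)
  have hΨc : Continuous Ψ := continuous_expTwoConj_abs.comp (continuous_const.mul continuous_id)
  have h0 : ∀ y, 0 ≤ Ψ y := fun y => expTwoConj_nonneg (abs_nonneg _)
  have h2 : ∀ y, Ψ y ≤ c ^ 2 * y ^ 2 := fun y =>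
    (expTwoConj_abs_le_sq _).trans_eq (by ring)
  have hMP := integral_convex_sub_le_integral_fderiv (μ := μ) (by simp [μ]) hΨconv hΨc h0
    (sq_nonneg c) h2 hf hfb hb
  have hi : Integrable (fun p : E × E => Ψ (π / 2 * fderiv ℝ f p.1 p.2)) (μ.prod μ) :=
    integrable_of_polynomial_growth
      (hΨc.comp (continuous_const.mul (continuous_fderiv_apply hf)))
      (abs_convex_fderiv_le h0 (sq_nonneg c) h2 _ hb)
  have hdi : Integrable (fun x => expTwoConj (‖fderiv ℝ f x‖ / α)) μ := by
    have hcont : Continuous fun x => ‖fderiv ℝ f x‖ / α :=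
      (hf.continuous_fderiv one_ne_zero).norm.div_const α
    refine integrable_of_polynomial_growth (C := C ^ 2 / α ^ 2) (m := m * 2)
      (continuousOn_expTwoConj.comp_continuous hcont fun x => by
        simp only [Set.mem_Ici]; positivity) fun x => ?_
    have hx : 0 ≤ ‖fderiv ℝ f x‖ / α := by positivity
    rw [abs_of_nonneg (expTwoConj_nonneg hx)]
    refine (expTwoConj_le_sq hx).trans ?_
    rw [div_pow, div_mul_eq_mul_div, pow_mul, ← mul_pow]
    gcongr
    exact hb x
  have hlhs : ∀ x, expTwoConj (|f x - ∫ y, f y ∂μ| / (κ⁻¹ * α)) = Ψ ((∫ y, f y ∂μ) - f x) := by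
    intro x
    simp only [hΨ]
    rw [abs_mul, abs_sub_comm (∫ y, f y ∂μ), abs_of_pos hc0, hc]
    congr 1
    field_simp
  simp_rw [hlhs]
  refine hMP.trans ?_
  rw [integral_prod _ hi, ← integral_const_mul]
  refine integral_mono hi.integral_prod_left (hdi.const_mul _) fun x => ?_
  have hcx : Continuous fun w : ℝ => Ψ (π / 2 * w) := hΨc.comp (continuous_const.mul continuous_id)
  have hmap : ∫ y, Ψ (π / 2 * fderiv ℝ f x y) ∂μ =
      ∫ z, Ψ (π / 2 * (‖fderiv ℝ f x‖ * z)) ∂gaussianReal 0 1 := by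
    rw [← integral_map (φ := fderiv ℝ f x) (f := fun w => Ψ (π / 2 * w)) (by fun_prop)
      hcx.aestronglyMeasurable, map_stdGaussian_strongDual,
      integral_map (by fun_prop) hcx.aestronglyMeasurable]
  simp only
  rw [hmap, ← integral_mul_const]
  refine integral_mono_of_nonneg (Filter.Eventually.of_forall fun z => h0 _)
    ((integrable_max_abs_sq_gaussianReal _).mul_const _)
    (Filter.Eventually.of_forall fun z => ?_)
  have hz : |c * (π / 2 * (‖fderiv ℝ f x‖ * z))| =
      (π / 2 * κ * |z|) * (‖fderiv ℝ f x‖ / α) := by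
    rw [abs_mul, abs_mul, abs_mul, abs_norm, abs_of_pos hc0, abs_of_pos (by positivity), hc]
    field_simp
  simp only [hΨ]
  rw [hz]
  exact expTwoConj_mul_le (by positivity) (by positivity)

theorem norm_gradient {E : Type*} [NormedAddCommGroup E] [InnerProductSpace ℝ E] [CompleteSpace E]
    (f : E → ℝ) (x : E) : ‖gradient f x‖ = ‖fderiv ℝ f x‖ :=
  (InnerProductSpace.toDual ℝ E).symm.norm_map _

open ProbabilityTheory in
theorem exists_integral_expTwoConj_le_one {E : Type*} [NormedAddCommGroup E] [NormedSpace ℝ E]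
    [CompleteSpace E] [SecondCountableTopology E] [MeasurableSpace E] [BorelSpace E]
    {μ : Measure E} [IsGaussian μ] {g : E → ℝ} (hg : Continuous g) (hg0 : ∀ x, 0 ≤ g x) {C : ℝ}
    {m : ℕ} (hb : ∀ x, g x ≤ C * (1 + ‖x‖) ^ m) :
    ∃ α : ℝ, 0 < α ∧ ∫ x, expTwoConj (g x / α) ∂μ ≤ 1 := by
  have hi : Integrable (fun x => g x ^ 2) μ := by
    refine integrable_of_polynomial_growth (C := C ^ 2) (m := m * 2) (by fun_prop) fun x => ?_
    rw [abs_of_nonneg (sq_nonneg _), pow_mul, ← mul_pow]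
    exact pow_le_pow_left₀ (hg0 x) (hb x) 2
  set I := ∫ x, g x ^ 2 ∂μ
  have hI : 0 ≤ I := integral_nonneg fun x => sq_nonneg _
  refine ⟨1 + I, by positivity, ?_⟩
  calc ∫ x, expTwoConj (g x / (1 + I)) ∂μ ≤ ∫ x, ((1 + I) ^ 2)⁻¹ * g x ^ 2 ∂μ := by
        have hx : ∀ x, 0 ≤ g x / (1 + I) := fun x => div_nonneg (hg0 x) (by positivity)
        refine integral_mono_of_nonneg (Filter.Eventually.of_forall fun x =>
          expTwoConj_nonneg (hx x)) (hi.const_mul _) (Filter.Eventually.of_forall fun x => ?_)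
        exact (expTwoConj_le_sq (hx x)).trans_eq (by rw [div_pow]; field_simp)
    _ = I / (1 + I) ^ 2 := by rw [integral_const_mul, inv_mul_eq_div]
    _ ≤ 1 := by
        rw [div_le_one (by positivity)]
        nlinarith

/-- Poincaré inequality for the Young function `(exp₂)_* (y) = (1+y)log(1+y) − y`
with the explicit constant `κ` solving `√(π/2) κ + (π²/4) κ² = 1`. -/
theorem orlicz_poincare_exp2_star (κ : ℝ) (hκ : 0 < κ)
    (hκeq : Real.sqrt (π / 2) * κ + (π ^ 2 / 4) * κ ^ 2 = 1) :
    (∫ z, max ((π / 2) * κ * |z|) (((π / 2) * κ * |z|) ^ 2) ∂ProbabilityTheory.gaussianReal 0 1 ≤ 1) ∧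
      ∀ (n : ℕ) (f : EuclideanSpace ℝ (Fin n) → ℝ), CPoly 1 n f →
        luxNorm n (fun y => (1 + y) * Real.log (1 + y) - y)
            (fun x => f x - ∫ y, f y ∂gaussianMeasure n) ≤
          κ⁻¹ * luxNorm n (fun y => (1 + y) * Real.log (1 + y) - y)
            (fun x => ‖gradient f x‖) := by
  have hpi := Real.pi_pos
  have hmax : ∫ z, max ((π / 2) * κ * |z|) (((π / 2) * κ * |z|) ^ 2)
      ∂ProbabilityTheory.gaussianReal 0 1 ≤ 1 := by
    refine (integral_max_abs_sq_gaussianReal_le (by positivity)).trans_eq ?_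
    have hs : π / 2 * Real.sqrt (2 / π) = Real.sqrt (π / 2) := by
      have h : 2 / π = (π / 2)⁻¹ := by rw [inv_div]
      rw [h, Real.sqrt_inv, ← div_eq_mul_inv, Real.div_sqrt]
    linear_combination κ * hs + hκeq
  refine ⟨hmax, fun n f hf => ?_⟩
  obtain ⟨hf1, hpoly⟩ := hf
  obtain ⟨C', m', hC'⟩ := hpoly 0 (by norm_num)
  obtain ⟨C, m, hC⟩ := hpoly 1 le_rfl
  have hfb : ∀ x, |f x| ≤ C' * (1 + ‖x‖) ^ m' := by simpa using hC'
  have hb : ∀ x, ‖fderiv ℝ f x‖ ≤ C * (1 + ‖x‖) ^ m := by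
    simpa only [norm_iteratedFDeriv_one] using hC
  have hf1 : ContDiff ℝ 1 f := by simpa using hf1
  simp only [luxNorm, gaussianMeasure_eq_stdGaussian, norm_gradient, abs_norm]
  rw [← smul_eq_mul, ← Real.sInf_smul_of_nonneg (by positivity)]
  refine csInf_le_csInf ⟨0, fun a ha => ha.1.le⟩
    (Set.Nonempty.smul_set (exists_integral_expTwoConj_le_one
      (hf1.continuous_fderiv one_ne_zero).norm (fun x => norm_nonneg _) hb)) ?_
  rintro _ ⟨α, ⟨hα, hle⟩, rfl⟩
  refine ⟨by simp only [smul_eq_mul]; positivity, ?_⟩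
  refine (integral_expTwoConj_sub_le hκ hα hf1 hfb hb).trans ?_
  exact mul_le_one₀ hmax (integral_nonneg fun x => expTwoConj_nonneg (by positivity)) hle
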